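/- arXiv:2108.03664 — 2 statements merged into one kernel-verified Lean document; each statement's English description precedes it below -/
import Mathlib

section
/- Let k ≥ 2 and k²+1 ≤ b ≤ k²+k be integers, and let l be an integer with l ≥ 2, where additionally l ≥ 3 in case b = 5. Suppose x = [0;a_1,a_2,…] is a Trott number in base b and its second partial quotient a_2 has exactly l digits in base b. Then a_2 = ⌈ b^l(b−k²)/k − b/(k(b−k²)) ⌉ − 1. -/
open Filter Topology

/-- Number of digits of `a` in base `b`. -/
def digLen (b a : ℕ) : ℕ := (Nat.digits b a).length

/-- Value of the finite continued fraction `[0; a₁, a₂, …, aₙ]`. -/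
noncomputable def cfVal : List ℕ → ℝ
  | [] => 0
  | (h :: t) => 1 / ((h : ℝ) + cfVal t)

/-- `a` witnesses that `x` is a Trott number in base `b`: the `a i` (indexed from 0)
are positive, `x` is the value of the infinite continued fraction `[0; a 0, a 1, …]`,
and the base-`b` expansion of `x` is the concatenation of the base-`b` digit strings
of the partial quotients. -/
def IsTrottWith (b : ℕ) (x : ℝ) (a : ℕ → ℕ) : Prop :=
  (∀ i, 0 < a i) ∧
  Tendsto (fun n => cfVal ((List.range n).map a)) atTop (𝓝 x) ∧
  x = ∑' i : ℕ, (a i : ℝ) / (b : ℝ) ^ (∑ j ∈ Finset.range (i + 1), digLen b (a j))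

/-- `x` is a Trott number in base `b`. -/
def IsTrott (b : ℕ) (x : ℝ) : Prop := ∃ a, IsTrottWith b x a

/-- The set of Trott numbers in base `b`. -/
def TrottSet (b : ℕ) : Set ℝ := {x | IsTrott b x}

/-- The value of a finite continued fraction with positive partial quotients is in `[0, 1]`. -/
lemma cfVal_mem_Icc (L : List ℕ) (hL : ∀ n ∈ L, 0 < n) : 0 ≤ cfVal L ∧ cfVal L ≤ 1 := by
  induction L with
  | nil => simp [cfVal]
  | cons h t ih =>
    obtain ⟨h0, -⟩ := ih fun n hn => hL n (List.mem_cons_of_mem _ hn)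
    have h1 : (1 : ℝ) ≤ h := by exact_mod_cast hL h List.mem_cons_self
    simp only [cfVal]
    exact ⟨by positivity, by rw [div_le_one (by linarith)]; linarith⟩

/-- A limit of continued fractions lies between its first two levels of bounds. -/
lemma cfVal_limit_bounds {x : ℝ} {a : ℕ → ℕ} (ha : ∀ i, 0 < a i)
    (hx : Tendsto (fun n => cfVal ((List.range n).map a)) atTop (𝓝 x)) :
    1 / ((a 0 : ℝ) + 1 / (a 1 : ℝ)) ≤ x ∧
      x ≤ 1 / ((a 0 : ℝ) + 1 / ((a 1 : ℝ) + 1)) := by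
  have h0 : (0 : ℝ) < a 0 := by exact_mod_cast ha 0
  have h1 : (0 : ℝ) < a 1 := by exact_mod_cast ha 1
  have key : ∀ n : ℕ, ∃ e : ℝ, 0 ≤ e ∧ e ≤ 1 ∧
      cfVal ((List.range (n + 2)).map a) = 1 / ((a 0 : ℝ) + 1 / ((a 1 : ℝ) + e)) := by
    intro n
    obtain ⟨he0, he1⟩ := cfVal_mem_Icc ((List.range n).map fun i => a (i + 2)) (by
      intro m hm
      obtain ⟨i, -, rfl⟩ := List.mem_map.1 hm
      exact ha _)
    refine ⟨_, he0, he1, ?_⟩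
    simp [List.range_succ_eq_map, cfVal, Function.comp_def]
  have hx2 := (tendsto_add_atTop_iff_nat 2).2 hx
  constructor
  · refine ge_of_tendsto' hx2 fun n => ?_
    obtain ⟨e, he0, he1, he⟩ := key n
    rw [he]
    gcongr
    linarith
  · refine le_of_tendsto' hx2 fun n => ?_
    obtain ⟨e, he0, he1, he⟩ := key n
    rw [he]
    gcongr

section Concatenation

variable {b : ℕ} {a : ℕ → ℕ}

/-- The partial sums of a digit concatenation plus one unit in the last place decrease. -/
lemma antitone_concat_partial_sum (hb : 2 ≤ b) :
    Antitone fun n => ∑ i ∈ Finset.range n,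
      (a i : ℝ) / (b : ℝ) ^ (∑ j ∈ Finset.range (i + 1), digLen b (a j)) +
        1 / (b : ℝ) ^ (∑ j ∈ Finset.range n, digLen b (a j)) := by
  have hb0 : (0 : ℝ) < b := by exact_mod_cast (by omega : 0 < b)
  refine antitone_nat_of_succ_le fun n => ?_
  have hd : (a n : ℝ) + 1 ≤ (b : ℝ) ^ digLen b (a n) := by
    exact_mod_cast Nat.lt_base_pow_length_digits (b := b) (m := a n) (by omega)
  rw [Finset.sum_range_succ, Finset.sum_range_succ _ n, pow_add, add_assoc, ← add_div]
  refine add_le_add_right ?_ _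
  rw [div_le_div_iff₀ (by positivity) (by positivity)]
  nlinarith [pow_pos hb0 (∑ j ∈ Finset.range n, digLen b (a j))]

lemma summable_concat (hb : 2 ≤ b) :
    Summable fun i => (a i : ℝ) / (b : ℝ) ^ (∑ j ∈ Finset.range (i + 1), digLen b (a j)) := by
  refine summable_of_sum_range_le (c := 1) (fun i => by positivity) fun n => ?_
  have h := antitone_concat_partial_sum (a := a) hb (Nat.zero_le n)
  have h0 : (0 : ℝ) ≤ 1 / (b : ℝ) ^ (∑ j ∈ Finset.range n, digLen b (a j)) := by positivity
  simp only [Finset.range_zero, Finset.sum_empty, pow_zero] at h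
  linarith

/-- A digit concatenation exceeds each truncation by at most one unit in the last place. -/
lemma concat_bounds (hb : 2 ≤ b) (ha : ∀ i, 0 < a i) (n : ℕ) :
    ∑ i ∈ Finset.range n,
        (a i : ℝ) / (b : ℝ) ^ (∑ j ∈ Finset.range (i + 1), digLen b (a j)) <
      ∑' i, (a i : ℝ) / (b : ℝ) ^ (∑ j ∈ Finset.range (i + 1), digLen b (a j)) ∧
    ∑' i, (a i : ℝ) / (b : ℝ) ^ (∑ j ∈ Finset.range (i + 1), digLen b (a j)) ≤
      ∑ i ∈ Finset.range n,
        (a i : ℝ) / (b : ℝ) ^ (∑ j ∈ Finset.range (i + 1), digLen b (a j)) +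
          1 / (b : ℝ) ^ (∑ j ∈ Finset.range n, digLen b (a j)) := by
  have hb0 : (0 : ℝ) < b := by exact_mod_cast (by omega : 0 < b)
  have hs := summable_concat (a := a) hb
  constructor
  · have h := hs.sum_le_tsum (Finset.range (n + 1)) fun i _ => by positivity
    rw [Finset.sum_range_succ] at h
    have hp : (0 : ℝ) < a n := by exact_mod_cast ha n
    have : 0 < (a n : ℝ) / (b : ℝ) ^ (∑ j ∈ Finset.range (n + 1), digLen b (a j)) := by
      positivity
    linarith
  · refine le_of_tendsto hs.hasSum.tendsto_sum_nat ?_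
    filter_upwards [eventually_ge_atTop n] with m hm
    have h := antitone_concat_partial_sum (a := a) hb hm
    have h0 : (0 : ℝ) ≤ 1 / (b : ℝ) ^ (∑ j ∈ Finset.range m, digLen b (a j)) := by positivity
    simp only at h
    linarith

end Concatenation

/-- The first partial quotient is a single digit equal to `⌊√b⌋`. -/
lemma first_quotient_eq {k b n p q : ℕ} (hk : 2 ≤ k) (hb1 : k ^ 2 + 1 ≤ b)
    (hb2 : b ≤ k ^ 2 + k) (hn : 1 ≤ n) (hp : b ^ (n - 1) ≤ p) (hq : b ≤ q)
    (h1 : p ^ 2 < b ^ n) (h2 : b ^ n * q ≤ (p + 1) * (p * q + 1)) : p = k ∧ n = 1 := by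
  have hn1 : n = 1 := by
    by_contra hne
    have h3 : b ^ n ≤ b ^ ((n - 1) * 2) := Nat.pow_le_pow_right (by omega) (by omega)
    rw [pow_mul] at h3
    have h4 := Nat.pow_le_pow_left hp 2
    omega
  subst hn1
  rw [pow_one] at h1 h2
  refine ⟨le_antisymm ?_ ?_, rfl⟩
  · by_contra! h
    nlinarith
  · by_contra! h
    have h3 : (p + 1) * (p * q + 1) ≤ k * (p * q + 1) := Nat.mul_le_mul_right _ h
    have h4 : k * ((p + 1) * q) ≤ k * (k * q) :=
      Nat.mul_le_mul_left _ (Nat.mul_le_mul_right _ h)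
    nlinarith

/-- Strict upper estimate for the second partial quotient. -/
lemma second_quotient_upper {k d B A : ℤ} (hd : 1 ≤ d) (hdk : d ≤ k) (hkB : k ≤ B)
    (hA : 0 ≤ A)
    (h : (k * B + A) * (k * (A + 1) + 1) < (A + 1) * ((k ^ 2 + d) * B)) :
    d * (k * A) + (k ^ 2 + d) < B * d ^ 2 := by
  obtain ⟨M, hM⟩ : ∃ M, M = k * (A + 1) + 1 := ⟨_, rfl⟩
  have hk : 1 ≤ k := hd.trans hdk
  have hB : 1 ≤ B := hk.trans hkB
  have hM0 : 0 < M := by rw [hM]; positivity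
  have hkA : k * A = M - k - 1 := by rw [hM]; ring
  have h1 : k * A * M + (k ^ 2 + d) * B < d * B * M := by
    have h2 : k * ((k * B + A) * M) < k * ((A + 1) * ((k ^ 2 + d) * B)) := by
      rw [hM]
      exact mul_lt_mul_of_pos_left h (by omega)
    have h3 : k * ((A + 1) * ((k ^ 2 + d) * B)) = (M - 1) * ((k ^ 2 + d) * B) := by
      rw [hM]; ring
    nlinarith
  have hMD : M ≤ B * d := by
    by_contra! hlt
    obtain ⟨t, ht⟩ : ∃ t, t = k + 1 + B * d - M := ⟨_, rfl⟩
    have h2 : (k ^ 2 + d) * B < t * M := by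
      rw [hkA] at h1
      rw [ht]
      nlinarith
    have htk : t ≤ k := by omega
    have hBd : B ≤ B * d := le_mul_of_one_le_right (by omega) hd
    have h3 : 0 ≤ (k - t) * (B * d + 1 - t) := mul_nonneg (by omega) (by omega)
    have h4 : t * M = k * (B * d + 1) - (k - t) * (B * d + 1 - t) := by
      rw [show M = k + 1 + B * d - t by omega]; ring
    have h5 : 0 ≤ (k - d) * (k - 1) * B := by
      have := sub_nonneg.2 hdk
      have := sub_nonneg.2 hk
      positivity
    nlinarith
  refine lt_of_mul_lt_mul_right (a := M) ?_ hM0.le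
  nlinarith [mul_le_mul_of_nonneg_left hMD (by positivity : 0 ≤ k ^ 2 + d),
    mul_lt_mul_of_pos_left h1 (by omega : 0 < d)]

/-- Lower estimate for the second partial quotient. -/
lemma second_quotient_lower {k d C A : ℤ} (hk : 2 ≤ k) (hd : 1 ≤ d) (hdk : d ≤ k)
    (hC : k ^ 2 + d ≤ C)
    (hC1 : d = 1 → (C = k ^ 2 + d ∧ 3 ≤ k) ∨ (k ^ 2 + d) ^ 2 ≤ C) (hA : C ≤ A)
    (h : A * ((k ^ 2 + d) * ((k ^ 2 + d) * C)) ≤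
      (k * ((k ^ 2 + d) * C) + A + 1) * (k * A + 1)) :
    (k ^ 2 + d) * C * d ^ 2 ≤ d * (k * (A + 1)) + (k ^ 2 + d) := by
  obtain ⟨b, hb⟩ : ∃ b, b = k ^ 2 + d := ⟨_, rfl⟩
  obtain ⟨N, hN⟩ : ∃ N, N = k * A + 1 := ⟨_, rfl⟩
  obtain ⟨u, hu⟩ : ∃ u, u = d * b * C - N - k + 1 := ⟨_, rfl⟩
  rw [← hb] at hC hC1 h ⊢
  have hb5 : 5 ≤ b := by nlinarith
  have hNC : k * C + 1 ≤ N := by rw [hN]; nlinarith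
  have hNu : N * u ≤ b ^ 2 * C := by
    have h2 := mul_le_mul_of_nonneg_left h (by omega : 0 ≤ k)
    have h3 : k * (A * (b * (b * C))) = (N - 1) * (b * (b * C)) := by rw [hN]; ring
    have h4 : k * ((k * (b * C) + A + 1) * (k * A + 1)) =
        ((b - d) * (b * C) + N + k - 1) * N := by rw [hN, hb]; ring
    rw [h3, h4] at h2
    rw [hu]
    linarith
  suffices hdu : d * u ≤ b by
    rw [hu, hN] at hdu
    linarith
  by_contra! hdu
  have hdu' : b + 1 ≤ d * u := hdu
  have hu0 : 0 < u := by
    by_contra! hle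
    nlinarith
  have hC0 : 0 < C := by omega
  have hkb : k ^ 2 + 1 ≤ b := by omega
  rcases lt_or_ge N u with hlt | hle
  · have h2 : d * b * C - k + 1 ≤ 2 * u := by linarith
    have h3 : k * C * (2 * u) ≤ 2 * (b ^ 2 * C) := by nlinarith
    have h4 : k * (d * b * C - k + 1) ≤ 2 * b ^ 2 := by
      refine le_of_mul_le_mul_right (a := C) ?_ hC0
      nlinarith [mul_le_mul_of_nonneg_left h2 (by positivity : 0 ≤ k * C)]
    have h5 : 3 * b ^ 2 ≤ k * (d * b * C) := by
      have hcase : 3 * b ≤ k * d * C := by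
        rcases hd.eq_or_lt with hd1 | hd2
        · rcases hC1 hd1.symm with ⟨-, h3k⟩ | hCb
          · rw [← hd1]; nlinarith
          · rw [← hd1]; nlinarith
        · have : 3 ≤ k * d := by nlinarith only [hk, hd2]
          nlinarith
      nlinarith
    nlinarith
  · have hP : N + u = d * b * C - k + 1 := by omega
    have hdN : b + 1 ≤ d * N := hdu'.trans (mul_le_mul_of_nonneg_left hle (by omega))
    have h2 : d ^ 2 * b * C ≤ (b + 1) * (d * (k - 1) + b + 1) := by
      have h3 := mul_nonneg (sub_nonneg.2 hdu') (sub_nonneg.2 hdN)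
      have h4 : d ^ 2 * (N * u) ≤ d ^ 2 * (b ^ 2 * C) :=
        mul_le_mul_of_nonneg_left hNu (by positivity)
      have h5 : d * (b + 1) * (N + u) = d * (b + 1) * (d * b * C - k + 1) := by rw [hP]
      linarith
    rcases hd.eq_or_lt with hd1 | hd2
    · subst hd1
      rcases hC1 rfl with ⟨hCb, h3k⟩ | hCb
      · rw [hCb] at hu hP hNu
        obtain ⟨q, hq⟩ : ∃ q, u = 1 + k * q :=
          ⟨k ^ 3 + 2 * k - A - 1, by rw [hu, hN, hb]; ring⟩
        have hqk : k + 1 ≤ q := by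
          by_contra! hlt
          nlinarith only [hlt, hq, hdu', hb, hk]
        have hub : b + k ≤ u := by rw [hq, hb]; nlinarith
        have h3 := mul_nonneg (sub_nonneg.2 hub) (sub_nonneg.2 (hub.trans hle))
        have h4 : (b + k) * (N + u) = (b + k) * (1 * b * b - k + 1) := by rw [hP]
        have h5 : (k - 1) * b ^ 2 - (3 * k - 1) * b - 2 * k ^ 2 + k ≤ 0 := by linarith
        have h6 : 2 ≤ (k - 1) * b - (3 * k - 1) := by nlinarith
        have h7 := mul_le_mul_of_nonneg_right h6 (by omega : 0 ≤ b)
        linarith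
      · have hkb' : k ≤ b := by nlinarith
        have h3 : b * b ^ 2 ≤ b * C := mul_le_mul_of_nonneg_left hCb (by omega)
        have h4 : (b + 1) * (b + k) ≤ (b + 1) * (2 * b) :=
          mul_le_mul_of_nonneg_left (by linarith) (by omega)
        have h5 : 5 * b ^ 2 ≤ b * b ^ 2 := mul_le_mul_of_nonneg_right hb5 (by positivity)
        nlinarith only [h2, h3, h4, h5, hb5]
    · have h3 : d * (k - 1) ≤ b - 4 := by
        have := mul_nonneg (by omega : 0 ≤ k) (sub_nonneg.2 hdk)
        linarith
      have h4 : (b + 1) * (d * (k - 1) + b + 1) ≤ (b + 1) * (2 * b - 3) :=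
        mul_le_mul_of_nonneg_left (by linarith) (by omega)
      have h5 : 4 * (b * b) ≤ d ^ 2 * (b * C) :=
        mul_le_mul (by nlinarith only [hd2]) (mul_le_mul_of_nonneg_left hC (by omega))
          (by positivity) (by positivity)
      have h6 : 0 ≤ b * b := by positivity
      linarith

/-- If `k ≥ 2`, `k²+1 ≤ b ≤ k²+k`, `x` is a Trott number in base `b`, and the second
partial quotient `a 1` of `x` has exactly `l` digits in base `b`, where `l ≥ 2` and
additionally `l ≥ 3` in case `b = 5`, then `a 1 = ⌈bˡ(b-k²)/k − b/(k(b-k²))⌉ − 1`. -/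
theorem trott_second_quotient_formula (k b l : ℕ) (hk : 2 ≤ k)
    (hb1 : k ^ 2 + 1 ≤ b) (hb2 : b ≤ k ^ 2 + k) (hl : 2 ≤ l) (hl5 : b = 5 → 3 ≤ l)
    (x : ℝ) (a : ℕ → ℕ) (hx : IsTrottWith b x a) (hdig : digLen b (a 1) = l) :
    (a 1 : ℤ) =
      ⌈(b : ℝ) ^ l * ((b : ℝ) - (k : ℝ) ^ 2) / (k : ℝ) -
        (b : ℝ) / ((k : ℝ) * ((b : ℝ) - (k : ℝ) ^ 2))⌉ - 1 := by
  obtain ⟨ha, hcf, hsum⟩ := hx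
  have hb5 : 5 ≤ b := by nlinarith
  obtain ⟨hcf1, hcf2⟩ := cfVal_limit_bounds ha hcf
  have hconcat := concat_bounds (by omega : 2 ≤ b) ha
  rw [← hsum] at hconcat
  obtain ⟨hs1, hs2⟩ := hconcat 1
  obtain ⟨hs3, hs4⟩ := hconcat 2
  have hn : 1 ≤ digLen b (a 0) :=
    (Nat.lt_digits_length_iff (by omega : 1 < b) (a 0)).2 ((pow_zero b).trans_le (ha 0))
  have hp : b ^ (digLen b (a 0) - 1) ≤ a 0 :=
    (Nat.lt_digits_length_iff (by omega : 1 < b) (a 0)).1 (by unfold digLen at *; omega)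
  have hA : b ^ (l - 1) ≤ a 1 :=
    (Nat.lt_digits_length_iff (by omega : 1 < b) (a 1)).1 (by unfold digLen at *; omega)
  have hbC : b ≤ b ^ (l - 1) := Nat.le_self_pow (by omega) b
  have hb0 : (0 : ℝ) < b := by exact_mod_cast (by omega : 0 < b)
  have hk0 : (0 : ℝ) < k := by exact_mod_cast (by omega : 0 < k)
  have h0 : (0 : ℝ) < a 0 := by exact_mod_cast ha 0
  have h1 : (0 : ℝ) < a 1 := by exact_mod_cast ha 1
  simp only [Finset.sum_range_succ, Finset.range_zero, Finset.sum_empty, zero_add, hdig,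
    pow_add, pow_zero, one_mul] at hs1 hs2 hs3 hs4
  obtain ⟨hak, hn1⟩ := first_quotient_eq hk hb1 hb2 hn hp (hbC.trans hA)
    (by
      have hlt : (a 0 : ℝ) / (b : ℝ) ^ digLen b (a 0) < 1 / (a 0 : ℝ) :=
        (hs1.trans_le hcf2).trans_le (one_div_le_one_div_of_le h0 (by
          have : (0 : ℝ) ≤ 1 / ((a 1 : ℝ) + 1) := by positivity
          linarith))
      rw [div_lt_div_iff₀ (by positivity) h0] at hlt
      rw [sq]
      exact_mod_cast (by linarith :
        (a 0 : ℝ) * a 0 < (b : ℝ) ^ digLen b (a 0)))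
    (by
      have hle := hcf1.trans hs2
      have he : (1 : ℝ) / ((a 0 : ℝ) + 1 / (a 1 : ℝ)) = a 1 / (a 0 * a 1 + 1) := by
        field_simp
      rw [he, ← add_div, div_le_div_iff₀ (by positivity) (by positivity)] at hle
      exact_mod_cast (by linarith : (b : ℝ) ^ digLen b (a 0) * a 1 ≤
        ((a 0 : ℝ) + 1) * (a 0 * a 1 + 1)))
  obtain ⟨d, rfl⟩ : ∃ d, b = k ^ 2 + d := ⟨b - k ^ 2, by omega⟩
  rw [hn1, hak, pow_one] at hs3 hs4
  rw [hak] at hcf1 hcf2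
  generalize a 1 = A at *
  have hd0 : (0 : ℝ) < d := by exact_mod_cast (by omega : 0 < d)
  obtain ⟨m, rfl⟩ : ∃ m, l = m + 1 := ⟨l - 1, by omega⟩
  rw [Nat.add_sub_cancel] at hA hbC
  have hupper := second_quotient_upper (k := k) (d := d) (B := (k ^ 2 + d : ℕ) ^ (m + 1))
    (A := A) (by omega) (by omega)
    (by
      have : k ≤ (k ^ 2 + d) ^ (m + 1) :=
        le_trans (by nlinarith) (Nat.le_self_pow (by omega) (k ^ 2 + d))
      exact_mod_cast this)
    (by positivity)
    (by
      have hlt := hs3.trans_le hcf2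
      have he1 : (1 : ℝ) / ((k : ℝ) + 1 / ((A : ℝ) + 1)) = (A + 1) / (k * (A + 1) + 1) := by
        field_simp
      have he2 : (k : ℝ) / ((k ^ 2 + d : ℕ) : ℝ) + A / (((k ^ 2 + d : ℕ) : ℝ) *
          ((k ^ 2 + d : ℕ) : ℝ) ^ (m + 1)) = (k * ((k ^ 2 + d : ℕ) : ℝ) ^ (m + 1) + A) /
            (((k ^ 2 + d : ℕ) : ℝ) * ((k ^ 2 + d : ℕ) : ℝ) ^ (m + 1)) := by
        field_simp
      rw [he1, he2, div_lt_div_iff₀ (by positivity) (by positivity)] at hlt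
      exact_mod_cast hlt)
  have hlower := second_quotient_lower (k := k) (d := d) (C := (k ^ 2 + d : ℕ) ^ m)
    (A := A) (by omega) (by omega) (by omega) (by exact_mod_cast hbC)
    (by
      intro hd1
      have hd1' : d = 1 := by exact_mod_cast hd1
      subst hd1'
      rcases (by omega : m = 1 ∨ 2 ≤ m) with rfl | hm
      · left
        refine ⟨by push_cast; ring, ?_⟩
        have : k ≠ 2 := by
          rintro rfl
          have := hl5 (by norm_num)
          omega
        omega
      · right
        exact_mod_cast Nat.pow_le_pow_right (by omega) hm)
    (by exact_mod_cast hA)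
    (by
      have hle := hcf1.trans hs4
      have he1 : (1 : ℝ) / ((k : ℝ) + 1 / (A : ℝ)) = A / (k * A + 1) := by
        field_simp
      have he2 : (k : ℝ) / ((k ^ 2 + d : ℕ) : ℝ) + A / (((k ^ 2 + d : ℕ) : ℝ) *
          ((k ^ 2 + d : ℕ) : ℝ) ^ (m + 1)) + 1 / (((k ^ 2 + d : ℕ) : ℝ) *
          ((k ^ 2 + d : ℕ) : ℝ) ^ (m + 1)) =
          (k * (((k ^ 2 + d : ℕ) : ℝ) * ((k ^ 2 + d : ℕ) : ℝ) ^ m) + A + 1) /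
            (((k ^ 2 + d : ℕ) : ℝ) * (((k ^ 2 + d : ℕ) : ℝ) * ((k ^ 2 + d : ℕ) : ℝ) ^ m)) := by
        rw [pow_succ' _ m]
        field_simp
      rw [he1, he2, div_le_div_iff₀ (by positivity) (by positivity)] at hle
      exact_mod_cast hle)
  have hupper' : (d : ℝ) * (k * A) + (k ^ 2 + d) <
      ((k ^ 2 + d : ℕ) : ℝ) ^ (m + 1) * d ^ 2 := by exact_mod_cast hupper
  have hlower' : ((k ^ 2 + d : ℕ) : ℝ) * ((k ^ 2 + d : ℕ) : ℝ) ^ m * d ^ 2 ≤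
      d * (k * (A + 1)) + (k ^ 2 + d) := by exact_mod_cast hlower
  rw [← pow_succ' _ m] at hlower'
  rw [eq_sub_iff_add_eq, eq_comm, Int.ceil_eq_iff]
  generalize ((k ^ 2 + d : ℕ) : ℝ) ^ (m + 1) = B at *
  have hbd : ((k ^ 2 + d : ℕ) : ℝ) - (k : ℝ) ^ 2 = d := by push_cast; ring
  have he : B * d / k - ((k ^ 2 + d : ℕ) : ℝ) / (k * d) =
      (B * d ^ 2 - (k ^ 2 + d)) / (k * d) := by
    push_cast
    field_simp
  rw [hbd, he, lt_div_iff₀ (by positivity), div_le_iff₀ (by positivity)]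
  push_cast
  constructor <;> linarith
end

section
/- Let k ≥ 2 and k²+1 ≤ b < c ≤ k²+k be integers, and suppose x = [0;k,a_2,a_3,…] is a Trott number in both base b and base c. Let a_2 have l digits in base b and m digits in base c. Then k²(c−b)/((b−k²)(c−k²)) − k < b^l(b−k²) − c^m(c−k²) < k²(c−b)/((b−k²)(c−k²)) + k, and in particular |b^l(b−k²) − c^m(c−k²)| < k². -/
open Filter Topology

theorem cfVal_nonneg (L : List ℕ) : 0 ≤ cfVal L := by
  induction L with
  | nil => simp [cfVal]
  | cons h t ih =>
    rw [cfVal]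
    positivity

theorem cfVal_le_one (L : List ℕ) (hL : ∀ n ∈ L, 0 < n) : cfVal L ≤ 1 := by
  cases L with
  | nil => simp [cfVal]
  | cons h t =>
    have h1 : (1 : ℝ) ≤ h := by exact_mod_cast hL h (by simp)
    have h2 := cfVal_nonneg t
    rw [cfVal, div_le_one (by linarith)]
    linarith

/-- A limit of continued fractions `[0; a 0, a 1, …]` equals `[0; a 0, w]` for some
complete quotient `w ∈ [a 1, a 1 + 1]`. -/
theorem exists_complete_quotient {x : ℝ} {a : ℕ → ℕ} (ha : ∀ i, 0 < a i)
    (hx : Tendsto (fun n => cfVal ((List.range n).map a)) atTop (𝓝 x)) :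
    ∃ w : ℝ, (a 1 : ℝ) ≤ w ∧ w ≤ a 1 + 1 ∧ x * (a 0 * w + 1) = w := by
  set f : ℝ → ℝ := fun w => w / (a 0 * w + 1) with hf
  have hpos : ∀ w ∈ Set.Icc (a 1 : ℝ) (a 1 + 1), 0 < (a 0 : ℝ) * w + 1 := by
    intro w hw
    have : (0 : ℝ) ≤ w := le_trans (by positivity) hw.1
    positivity
  have hcont : ContinuousOn f (Set.Icc (a 1 : ℝ) (a 1 + 1)) :=
    continuousOn_id.div (by fun_prop) fun w hw => (hpos w hw).ne'
  have hclosed : IsClosed (f '' Set.Icc (a 1 : ℝ) (a 1 + 1)) :=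
    (isCompact_Icc.image_of_continuousOn hcont).isClosed
  have hmem : x ∈ f '' Set.Icc (a 1 : ℝ) (a 1 + 1) := by
    refine hclosed.mem_of_tendsto ((tendsto_add_atTop_iff_nat 2).2 hx)
      (Eventually.of_forall fun n => ?_)
    set t := cfVal (((List.range n).map (fun i => i + 2)).map a) with ht
    have ht0 : 0 ≤ t := cfVal_nonneg _
    have ht1 : t ≤ 1 := cfVal_le_one _ (by simp [ha])
    have h1 : (0 : ℝ) < a 1 := by exact_mod_cast ha 1
    have h0 : (0 : ℝ) < a 0 := by exact_mod_cast ha 0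
    refine ⟨a 1 + t, ⟨by linarith, by linarith⟩, ?_⟩
    have hval : cfVal ((List.range (n + 2)).map a) = 1 / (a 0 + 1 / (a 1 + t)) := by
      rw [List.range_succ_eq_map, List.range_succ_eq_map]
      simp only [List.map_cons, List.map_map, cfVal, ht]
      rfl
    simp only [hval, hf]
    have h3 : 0 < (a 1 : ℝ) + t := by linarith
    field_simp
  obtain ⟨w, hw, rfl⟩ := hmem
  exact ⟨w, hw.1, hw.2, div_mul_cancel₀ _ (hpos w hw).ne'⟩

theorem lt_pow_digLen {b : ℕ} (hb : 1 < b) (n : ℕ) : n < b ^ digLen b n :=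
  Nat.lt_base_pow_length_digits hb

theorem pow_le_of_digLen_eq_succ {b n d : ℕ} (hb : 1 < b)
    (hd : digLen b n = d + 1) : b ^ d ≤ n := by
  rw [← Nat.lt_digits_length_iff hb]
  change d < digLen b n
  omega

theorem digLen_pos {b n : ℕ} (hn : 0 < n) : 0 < digLen b n :=
  List.length_pos_of_ne_nil (Nat.digits_ne_nil_iff_ne_zero.2 hn.ne')

/-- In the base-`b` expansion of a Trott number whose first partial quotient is a single
digit, removing that digit and shifting by the length of `a 1` leaves `a 1` plus a
fractional part of at least `1 / b`. -/
theorem IsTrottWith.shifted_mem {b : ℕ} {x : ℝ} {a : ℕ → ℕ} (h : IsTrottWith b x a)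
    (hb : a 0 < b) (hb1 : 1 < b) :
    (a 1 : ℝ) + 1 / b ≤ (b : ℝ) ^ digLen b (a 1) * (b * x - a 0) ∧
      (b : ℝ) ^ digLen b (a 1) * (b * x - a 0) ≤ a 1 + 1 := by
  obtain ⟨hpos, -, hx⟩ := h
  set P : ℕ → ℕ := fun n => ∑ j ∈ Finset.range n, digLen b (a j) with hP
  set f : ℕ → ℝ := fun i => (a i : ℝ) / (b : ℝ) ^ P (i + 1) with hf
  have hb0 : (0 : ℝ) < b := by exact_mod_cast (zero_lt_one.trans hb1)
  have hPs : ∀ n, P (n + 1) = P n + digLen b (a n) := fun n => Finset.sum_range_succ _ _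
  have hf0 : ∀ i, 0 ≤ f i := fun i => by positivity
  have hterm : ∀ i, f i + 1 / (b : ℝ) ^ P (i + 1) ≤ 1 / (b : ℝ) ^ P i := by
    intro i
    have h1 : (a i : ℝ) + 1 ≤ (b : ℝ) ^ digLen b (a i) := by
      exact_mod_cast lt_pow_digLen hb1 (a i)
    simp only [hf]
    rw [← add_div, hPs, div_le_div_iff₀ (by positivity) (by positivity), pow_add]
    nlinarith [pow_pos hb0 (P i)]
  have hpart : ∀ n, ∑ i ∈ Finset.range (n + 2), f i + 1 / (b : ℝ) ^ P (n + 2) ≤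
      ∑ i ∈ Finset.range 2, f i + 1 / (b : ℝ) ^ P 2 := by
    intro n
    induction n with
    | zero => simp
    | succ n ih =>
      rw [show n + 1 + 2 = (n + 2) + 1 by ring, Finset.sum_range_succ]
      linarith [hterm (n + 2)]
  have hbound : ∀ n, ∑ i ∈ Finset.range n, f i ≤
      ∑ i ∈ Finset.range 2, f i + 1 / (b : ℝ) ^ P 2 := by
    intro n
    have h1 : ∑ i ∈ Finset.range n, f i ≤ ∑ i ∈ Finset.range (n + 2), f i :=
      Finset.sum_le_sum_of_subset_of_nonneg (Finset.range_mono (by omega)) fun i _ _ => hf0 i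
    have h2 : 0 ≤ 1 / (b : ℝ) ^ P (n + 2) := by positivity
    linarith [hpart n]
  have hsum : Summable f := summable_of_sum_range_le hf0 hbound
  have hup : x ≤ ∑ i ∈ Finset.range 2, f i + 1 / (b : ℝ) ^ P 2 := by
    rw [hx]
    exact hsum.tsum_le_of_sum_range_le hbound
  have hlow : ∑ i ∈ Finset.range 3, f i ≤ x := by
    rw [hx]
    exact hsum.sum_le_tsum _ fun i _ => hf0 i
  have hd0 : digLen b (a 0) = 1 := by
    simp [digLen, Nat.digits_of_lt b (a 0) (hpos 0).ne' hb]
  have hP1 : P 1 = 1 := by simp [hP, hd0]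
  have hP2 : P 2 = digLen b (a 1) + 1 := by rw [hPs 1, hP1, add_comm]
  have hf2 : 1 / (b : ℝ) ^ (P 2 + 1) ≤ f 2 := by
    obtain ⟨d, hd⟩ := Nat.exists_eq_succ_of_ne_zero (digLen_pos (b := b) (hpos 2)).ne'
    have h1 : (b : ℝ) ^ d ≤ a 2 := by
      exact_mod_cast pow_le_of_digLen_eq_succ hb1 hd
    simp only [hf]
    rw [hPs 2, hd, div_le_div_iff₀ (by positivity) (by positivity), Nat.succ_eq_add_one,
      ← add_assoc, add_right_comm, pow_add _ _ d]
    nlinarith [pow_pos hb0 (P 2 + 1)]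
  have hS2 : ∑ i ∈ Finset.range 2, f i = a 0 / b + a 1 / (b : ℝ) ^ (digLen b (a 1) + 1) := by
    rw [Finset.sum_range_succ, Finset.sum_range_one]
    simp only [hf, zero_add, hP1, pow_one, one_add_one_eq_two, hP2]
  rw [Finset.sum_range_succ, hS2] at hlow
  rw [hS2] at hup
  rw [hP2] at hup hf2
  set B : ℝ := (b : ℝ) ^ digLen b (a 1) with hB
  have hBpos : 0 < B := by positivity
  have hlow' : (a 0 : ℝ) / b + a 1 / (B * b) + 1 / (B * b * b) ≤ x := by
    simp only [pow_succ] at hlow hf2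
    linarith
  simp only [pow_succ] at hup
  constructor
  · calc (a 1 : ℝ) + 1 / b
        = B * (b * (a 0 / b + a 1 / (B * b) + 1 / (B * b * b)) - a 0) := by
          field_simp
          ring
      _ ≤ _ := by gcongr
  · calc B * (b * x - a 0)
        ≤ B * (b * (a 0 / b + a 1 / (B * b) + 1 / (B * b)) - a 0) := by gcongr
      _ = _ := by
          field_simp
          ring

/-- Writing `β = b - k²`, the relation between a complete quotient `w` and the shifted
expansion `u` determines `bˡ β` up to an explicit small error. -/
theorem pow_mul_sub_eq {k b B x w u : ℝ} (hw : x * (k * w + 1) = w)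
    (hu : B * (b * x - k) = u) (hβ : b - k ^ 2 ≠ 0) (hkw : k * w + 1 ≠ 0)
    (hden : (b - k ^ 2) * w - k ≠ 0) :
    B * (b - k ^ 2) = k * u + 1 + k ^ 2 / (b - k ^ 2) +
      b / (b - k ^ 2) * (((b - k ^ 2) * (u - w) + k) / ((b - k ^ 2) * w - k)) := by
  have hx : x = w / (k * w + 1) := (eq_div_iff hkw).2 hw
  have h1 : B * ((b - k ^ 2) * w - k) = u * (k * w + 1) := by
    rw [← hu, hx]
    field_simp
    ring
  have hB : B = u * (k * w + 1) / ((b - k ^ 2) * w - k) := (eq_div_iff hden).2 h1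
  obtain ⟨β, rfl⟩ : ∃ β, b = β + k ^ 2 := ⟨b - k ^ 2, by ring⟩
  rw [add_sub_cancel_right] at hβ hden hB ⊢
  obtain ⟨d, hd⟩ : ∃ d, β * w - k = d := ⟨_, rfl⟩
  rw [hd] at hden hB ⊢
  obtain rfl : k = β * w - d := by linarith
  rw [hB]
  field_simp
  ring

/-- If a complete quotient `w ≥ bˡ` satisfies the size constraint coming from expansions in
the bases `b` and `c ≤ 6b/5`, then `l` is at least `3`. -/
theorem three_le_exponent {k b c w : ℝ} {l : ℕ} (hk : 2 ≤ k) (hb : k ^ 2 + 1 ≤ b)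
    (hcb : 5 * c ≤ 6 * b) (hc : 0 ≤ c) (hw : b ^ l ≤ w) (hl : 0 < l)
    (h : b ^ (l + 1) * (w - k) ≤ c ^ l * (k * w + 1)) : 3 ≤ l := by
  by_contra! hlt
  have hb5 : 5 ≤ b := by nlinarith
  have hw0 : 0 ≤ w := le_trans (by positivity) hw
  have hpow : (5 : ℝ) ^ l * c ^ l ≤ 6 ^ l * b ^ l := by
    rw [← mul_pow, ← mul_pow]
    gcongr
  have hkey : (5 : ℝ) ^ l * b * (w - k) ≤ 6 ^ l * (k * w + 1) := by
    refine le_of_mul_le_mul_left ?_ (by positivity : 0 < b ^ l)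
    calc b ^ l * (5 ^ l * b * (w - k)) = 5 ^ l * (b ^ (l + 1) * (w - k)) := by ring
      _ ≤ 5 ^ l * (c ^ l * (k * w + 1)) := by gcongr
      _ = 5 ^ l * c ^ l * (k * w + 1) := by ring
      _ ≤ 6 ^ l * b ^ l * (k * w + 1) := by gcongr
      _ = _ := by ring
  have hl12 : l = 1 ∨ l = 2 := by omega
  rcases hl12 with rfl | rfl
  · have h11 : 3 ≤ 5 * b - 11 * k := by nlinarith
    have h1 := mul_le_mul_of_nonneg_right hw (by linarith : 0 ≤ 5 * b - 6 * k)
    have h2 := mul_le_mul_of_nonneg_left h11 (by linarith : 0 ≤ b)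
    linarith
  · have h2k : 2 * k + 1 ≤ b := by nlinarith
    have h1 := mul_le_mul_of_nonneg_right hw (by linarith : 0 ≤ 25 * b - 36 * k)
    have h2 := mul_le_mul_of_nonneg_left h2k (by linarith : 0 ≤ b)
    have h3 := mul_le_mul_of_nonneg_left h2k (by positivity : 0 ≤ b ^ 2)
    have h4 : 25 ≤ b ^ 2 := by nlinarith
    have h5 : 0 ≤ b ^ 2 * b := by positivity
    linarith

/-- Bounds for the error term in `pow_mul_sub_eq`. -/
theorem error_term_bounds {k b c β u w : ℝ} (hk : 0 < k) (hb : 0 < b) (hβ : 1 ≤ β)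
    (hβk : β ≤ k) (hc : 0 < c) (hwk : k < w) (h1 : -1 ≤ u - w) (h2 : u - w ≤ 1)
    (h : (k + 1) * b * c < k * (w - k)) :
    0 ≤ b / β * ((β * (u - w) + k) / (β * w - k)) ∧
      b / β * ((β * (u - w) + k) / (β * w - k)) < k / c := by
  have hden : w - k ≤ β * w - k := by nlinarith
  have hden0 : 0 < β * w - k := by linarith
  have hnum : 0 ≤ β * (u - w) + k := by nlinarith
  refine ⟨by positivity, ?_⟩
  have hnum' : β * (u - w) + k ≤ β * (k + 1) := by nlinarith
  calc b / β * ((β * (u - w) + k) / (β * w - k))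
      ≤ b / β * (β * (k + 1) / (w - k)) := by
        have : 0 < w - k := by linarith
        gcongr
    _ = b * (k + 1) / (w - k) := by field_simp
    _ < k / c := by
        rw [div_lt_div_iff₀ (by linarith) hc]
        linarith

/-- Size estimate making the error terms of `pow_mul_sub_eq` smaller than `k / c`. -/
theorem mul_sq_lt_of_cube_le {k b c w : ℝ} (hk : 2 ≤ k) (hb : k ^ 2 + 1 ≤ b) (hc0 : 0 ≤ c)
    (hc : c ≤ k ^ 2 + k) (hcb : 5 * c ≤ 6 * b) (hw : b ^ 3 ≤ w) :
    (k + 1) * c * c < k * (w - k) := by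
  have hb5 : 5 ≤ b := by nlinarith
  have hkb : k ≤ b := by nlinarith
  have hk2b : (k + 1) ^ 2 ≤ 2 * b := by nlinarith [sq_nonneg (k - 1)]
  have h1 : (k + 1) * c ≤ k * (2 * b) :=
    calc (k + 1) * c ≤ (k + 1) * (k ^ 2 + k) := by gcongr
      _ = k * (k + 1) ^ 2 := by ring
      _ ≤ k * (2 * b) := by gcongr
  have h2 : 2 * b * c < w - k := by
    have h3 := mul_le_mul_of_nonneg_left hcb (by linarith : 0 ≤ b)
    have h4 := mul_le_mul_of_nonneg_right hb5 (sq_nonneg b)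
    have h5 := mul_le_mul_of_nonneg_left hb5 (by linarith : 0 ≤ b)
    linarith
  calc (k + 1) * c * c ≤ k * (2 * b) * c := by gcongr
    _ = k * (2 * b * c) := by ring
    _ < k * (w - k) := by gcongr

/-- The sandwich estimate, for expansions `u = B (b x - k)` and `v = C (c x - k)` shifted past
a common second partial quotient `A`, once the complete quotient `w` is large enough. -/
theorem sandwich_of_size {k b c x w A B C : ℝ} (hkR : 2 ≤ k) (hbR : k ^ 2 + 1 ≤ b)
    (hbcR : b + 1 ≤ c) (hcR : c ≤ k ^ 2 + k) (hw : x * (k * w + 1) = w) (hw1 : A ≤ w)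
    (hw2 : w ≤ A + 1) (hub : A + 1 / b ≤ B * (b * x - k) ∧ B * (b * x - k) ≤ A + 1)
    (huc : A + 1 / c ≤ C * (c * x - k) ∧ C * (c * x - k) ≤ A + 1)
    (hsize : (k + 1) * c * c < k * (w - k)) :
    (k ^ 2 * (c - b) / ((b - k ^ 2) * (c - k ^ 2)) - k <
        B * (b - k ^ 2) - C * (c - k ^ 2) ∧
      B * (b - k ^ 2) - C * (c - k ^ 2) <
        k ^ 2 * (c - b) / ((b - k ^ 2) * (c - k ^ 2)) + k) ∧
    |B * (b - k ^ 2) - C * (c - k ^ 2)| < k ^ 2 := by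
  have hk0 : 0 < k := by linarith
  have hb0 : 0 < b := by nlinarith
  have hc0 : 0 < c := by linarith
  have hsize' : (k + 1) * b * c < k * (w - k) := by
    refine lt_of_le_of_lt ?_ hsize
    gcongr
    linarith
  have hwk : k < w := by
    have : 0 < k * (w - k) := lt_of_le_of_lt (by positivity) hsize
    linarith [pos_of_mul_pos_right this (by linarith)]
  have hkw : k * w + 1 ≠ 0 := by
    have hw0 : 0 < w := hk0.trans hwk
    positivity
  have hib : 0 < 1 / b := by positivity
  have hic : 0 < 1 / c := by positivity
  set β : ℝ := b - k ^ 2 with hβ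
  set γ : ℝ := c - k ^ 2 with hγ
  have hβ1 : 1 ≤ β := by linarith
  have hβγ : β + 1 ≤ γ := by linarith
  have hγk : γ ≤ k := by linarith
  have hβw : k < β * w := hwk.trans_le (le_mul_of_one_le_left (by linarith) hβ1)
  have hγw : k < γ * w := hwk.trans_le (le_mul_of_one_le_left (by linarith) (by linarith))
  obtain ⟨u, hu⟩ : ∃ u, B * (b * x - k) = u := ⟨_, rfl⟩
  obtain ⟨v, hv⟩ : ∃ v, C * (c * x - k) = v := ⟨_, rfl⟩
  have eb := pow_mul_sub_eq hw hu (by linarith) hkw (by linarith)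
  have ec := pow_mul_sub_eq hw hv (by linarith) hkw (by linarith)
  rw [← hβ] at eb
  rw [← hγ] at ec
  rw [hu] at hub
  rw [hv] at huc
  obtain ⟨hu1, hu2⟩ := hub
  obtain ⟨hv1, hv2⟩ := huc
  obtain ⟨Eb0, Eb1⟩ := error_term_bounds (u := u) (by linarith) (by linarith) hβ1
    (by linarith) (by linarith) hwk (by linarith) (by linarith) hsize'
  obtain ⟨Ec0, Ec1⟩ := error_term_bounds (u := v) (by linarith) (by linarith)
    (by linarith : 1 ≤ γ) hγk (by linarith) hwk (by linarith) (by linarith) hsize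
  have hmain : k ^ 2 * (c - b) / (β * γ) = k ^ 2 / β - k ^ 2 / γ := by
    have : c - b = γ - β := by ring
    rw [this]
    have hβ0 : β ≠ 0 := by linarith
    have hγ0 : γ ≠ 0 := by linarith
    field_simp
  have hcb : k / c ≤ k / b := by gcongr; linarith
  have huv : k * (u - v) ≤ k - k / c := by
    have h : u - v ≤ 1 - 1 / c := by linarith
    calc k * (u - v) ≤ k * (1 - 1 / c) := by gcongr
      _ = _ := by ring
  have hvu : k * (v - u) ≤ k - k / b := by
    have h : v - u ≤ 1 - 1 / b := by linarith
    calc k * (v - u) ≤ k * (1 - 1 / b) := by gcongr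
      _ = _ := by ring
  have hlt : k ^ 2 / γ < k ^ 2 / β := by gcongr; linarith
  have hβle : k ^ 2 / β ≤ k ^ 2 := div_le_self (by positivity) hβ1
  have hγge : k ≤ k ^ 2 / γ := by
    rw [le_div_iff₀ (by linarith)]
    nlinarith
  rw [hmain]
  have hlower : k ^ 2 / β - k ^ 2 / γ - k < B * β - C * γ := by linarith
  have hupper : B * β - C * γ < k ^ 2 / β - k ^ 2 / γ + k := by linarith
  refine ⟨⟨hlower, hupper⟩, abs_lt.2 ⟨?_, by linarith⟩⟩
  have hk2 : k ≤ k ^ 2 := le_self_pow₀ (by linarith) two_ne_zero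
  linarith

/-- If `x = [0; k, a 1, a 2, …]` is Trott in two bases `k²+1 ≤ b < c ≤ k²+k`, and the
second partial quotient `a 1` has `l` digits in base `b` and `m` digits in base `c`, then
`k²(c-b)/((b-k²)(c-k²)) − k < bˡ(b-k²) − cᵐ(c-k²) < k²(c-b)/((b-k²)(c-k²)) + k`, and in
particular `|bˡ(b-k²) − cᵐ(c-k²)| < k²`. -/
theorem trott_two_bases_sandwich (k b c : ℕ) (hk : 2 ≤ k)
    (hb : k ^ 2 + 1 ≤ b) (hbc : b < c) (hc : c ≤ k ^ 2 + k)
    (x : ℝ) (a : ℕ → ℕ) (ha0 : a 0 = k)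
    (hxb : IsTrottWith b x a) (hxc : IsTrottWith c x a)
    (l m : ℕ) (hl : digLen b (a 1) = l) (hm : digLen c (a 1) = m) :
    ((k : ℝ) ^ 2 * ((c : ℝ) - (b : ℝ)) /
        (((b : ℝ) - (k : ℝ) ^ 2) * ((c : ℝ) - (k : ℝ) ^ 2)) - (k : ℝ) <
      (b : ℝ) ^ l * ((b : ℝ) - (k : ℝ) ^ 2) - (c : ℝ) ^ m * ((c : ℝ) - (k : ℝ) ^ 2) ∧
      (b : ℝ) ^ l * ((b : ℝ) - (k : ℝ) ^ 2) - (c : ℝ) ^ m * ((c : ℝ) - (k : ℝ) ^ 2) <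
      (k : ℝ) ^ 2 * ((c : ℝ) - (b : ℝ)) /
        (((b : ℝ) - (k : ℝ) ^ 2) * ((c : ℝ) - (k : ℝ) ^ 2)) + (k : ℝ)) ∧
    |(b : ℝ) ^ l * ((b : ℝ) - (k : ℝ) ^ 2) - (c : ℝ) ^ m * ((c : ℝ) - (k : ℝ) ^ 2)| <
      (k : ℝ) ^ 2 := by
  have hpos := hxb.1
  have hb1 : 1 < b := by nlinarith
  have hkb : k < b := by nlinarith
  have hub := hxb.shifted_mem (by omega) hb1
  have huc := hxc.shifted_mem (by omega) (by omega)
  obtain ⟨w, hw1, hw2, hw⟩ := exists_complete_quotient hpos hxb.2.1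
  have hlpos : 0 < l := hl ▸ digLen_pos (hpos 1)
  have hmpos : 0 < m := hm ▸ digLen_pos (hpos 1)
  have hAb : a 1 < b ^ l := hl ▸ lt_pow_digLen hb1 _
  have hAc : a 1 < c ^ m := hm ▸ lt_pow_digLen (by omega) _
  obtain ⟨l, rfl⟩ := Nat.exists_eq_add_one_of_ne_zero hlpos.ne'
  obtain ⟨m, rfl⟩ := Nat.exists_eq_add_one_of_ne_zero hmpos.ne'
  have hbA : b ^ l ≤ a 1 := pow_le_of_digLen_eq_succ hb1 hl
  have hcA : c ^ m ≤ a 1 := pow_le_of_digLen_eq_succ (by omega) hm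
  rw [hl, ha0] at hub
  rw [hm, ha0] at huc
  rw [ha0] at hw
  have hA1 : (1 : ℝ) ≤ a 1 := by exact_mod_cast hpos 1
  have hkR : (2 : ℝ) ≤ k := by exact_mod_cast hk
  have hbR : (k : ℝ) ^ 2 + 1 ≤ b := by exact_mod_cast hb
  have hbcR : (b : ℝ) + 1 ≤ c := by exact_mod_cast hbc
  have hcR : (c : ℝ) ≤ k ^ 2 + k := by exact_mod_cast hc
  have hb5 : (5 : ℝ) ≤ b := by nlinarith
  have hkw : 0 < (k : ℝ) * w + 1 := by nlinarith
  have h56 : 5 * (c : ℝ) ≤ 6 * b := by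
    have h : 0 ≤ ((k : ℝ) - 2) * (k - 3) := by
      rcases hk.eq_or_lt with rfl | h3
      · norm_num
      · have : (3 : ℝ) ≤ k := by exact_mod_cast h3
        exact mul_nonneg (by linarith) (by linarith)
    nlinarith
  -- the number of digits in base `b` exceeds that in base `c`
  have hml : m < l := by
    refine lt_of_le_of_ne ?_ ?_
    · by_contra! hlt
      have h1 : b ^ (l + 1) ≤ c ^ m :=
        (Nat.pow_le_pow_left hbc.le _).trans (Nat.pow_le_pow_right (by omega) hlt)
      omega
    · rintro rfl
      have hx1 : 1 ≤ x * (k + 1) := by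
        by_contra! hlt
        nlinarith
      have hx0 : 0 < x := pos_of_mul_pos_left (by linarith) (by linarith : (0 : ℝ) ≤ k + 1)
      have hbx : 1 < (b : ℝ) * x := by nlinarith
      have hib : (0 : ℝ) ≤ 1 / b := by positivity
      have hic : (0 : ℝ) ≤ 1 / c := by positivity
      have hcx : 0 ≤ (c : ℝ) * x - k :=
        (pos_of_mul_pos_right (by linarith) (by positivity : (0 : ℝ) ≤ c ^ (m + 1))).le
      have hpow : (b : ℝ) ≤ (b : ℝ) ^ (m + 1) := le_self_pow₀ (by linarith) (by omega)
      have hle : (b : ℝ) ^ (m + 1) * (b * x - k) + b * x ≤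
          (c : ℝ) ^ (m + 1) * (c * x - k) :=
        calc _ ≤ (b : ℝ) ^ (m + 1) * (b * x - k) + (b : ℝ) ^ (m + 1) * x := by gcongr
          _ = (b : ℝ) ^ (m + 1) * ((b + 1) * x - k) := by ring
          _ ≤ (b : ℝ) ^ (m + 1) * (c * x - k) := by gcongr
          _ ≤ _ := by gcongr
      linarith
  -- multiplying out the upper bound for the shifted expansion
  have hmul : (b : ℝ) ^ (l + 1) * ((b - k ^ 2) * w - k) ≤ (a 1 + 1) * (k * w + 1) := by
    have h1 : (b : ℝ) ^ (l + 1) * ((b - k ^ 2) * w - k) =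
        (b : ℝ) ^ (l + 1) * (b * x - k) * (k * w + 1) := by
      linear_combination (-(b : ℝ) ^ (l + 1) * b) * hw
    rw [h1]
    gcongr
    exact hub.2
  have hbAR : (b : ℝ) ^ l ≤ a 1 := by exact_mod_cast hbA
  have hl3 : 3 ≤ l := by
    have hAcR : (a 1 : ℝ) + 1 ≤ (c : ℝ) ^ l := by
      have : c ^ (m + 1) ≤ c ^ l := Nat.pow_le_pow_right (by omega) hml
      exact_mod_cast (Nat.succ_le_of_lt hAc).trans this
    refine three_le_exponent hkR hbR h56 (by positivity) (hbAR.trans hw1) (by omega) ?_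
    calc (b : ℝ) ^ (l + 1) * (w - k)
        ≤ (b : ℝ) ^ (l + 1) * ((b - k ^ 2) * w - k) := by
          gcongr
          nlinarith
      _ ≤ (a 1 + 1) * (k * w + 1) := hmul
      _ ≤ _ := by gcongr
  have hwb : (b : ℝ) ^ 3 ≤ w :=
    ((pow_le_pow_right₀ (by linarith) hl3).trans hbAR).trans hw1
  exact sandwich_of_size hkR hbR hbcR hcR hw hw1 hw2 hub huc
    (mul_sq_lt_of_cube_le hkR hbR (by linarith) hcR h56 hwb)
end
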